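/- arXiv:0706.0429 — 6 statements merged into one kernel-verified Lean document; each statement's English description precedes it below -/
import Mathlib

section
/- Let n ≥ 1 and let K, P, A be real n×n matrices with P symmetric and invertible. Assume that A = (1/2)(K + Kᵀ), that the matrix K·P⁻¹·A is symmetric, and that ‖I − P⁻¹·A‖ < 1 in the ℓ²-operator norm. Then K is symmetric, and consequently A = K. -/
open Matrix

/-- The ℓ²-operator norm (spectral norm) of a real square matrix. -/
noncomputable def l2OpNorm {n : ℕ} (B : Matrix (Fin n) (Fin n) ℝ) : ℝ :=
  ‖(Matrix.toEuclideanCLM (𝕜 := ℝ) B : EuclideanSpace ℝ (Fin n) →L[ℝ] EuclideanSpace ℝ (Fin n))‖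

open scoped Matrix.Norms.L2Operator in
theorem l2OpNorm_eq_norm {n : ℕ} (B : Matrix (Fin n) (Fin n) ℝ) : l2OpNorm B = ‖B‖ := rfl

open scoped Matrix.Norms.L2Operator in
/-- If `‖1 - M‖ < 1`, the Sylvester equation `W * M + Mᵀ * W = 0` has only the zero solution. -/
theorem eq_zero_of_mul_add_transpose_mul_eq_zero {n : ℕ} {W M : Matrix (Fin n) (Fin n) ℝ}
    (h : W * M + Mᵀ * W = 0) (hM : l2OpNorm (1 - M) < 1) : W = 0 := by
  rw [l2OpNorm_eq_norm] at hM
  have hW : W + W = W * (1 - M) + (1 - M)ᵀ * W := by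
    calc W + W = W + W - (W * M + Mᵀ * W) := by rw [h, sub_zero]
      _ = _ := by rw [transpose_sub, transpose_one]; noncomm_ring
  have hT : ‖(1 - M)ᵀ‖ = ‖1 - M‖ := by
    rw [← conjTranspose_eq_transpose_of_trivial, l2_opNorm_conjTranspose]
  have hle : 2 * ‖W‖ ≤ 2 * ‖1 - M‖ * ‖W‖ := by
    calc 2 * ‖W‖ = ‖W + W‖ := by
          rw [← two_smul ℝ W, norm_smul, Real.norm_ofNat]
      _ = ‖W * (1 - M) + (1 - M)ᵀ * W‖ := by rw [← hW]
      _ ≤ ‖W‖ * ‖1 - M‖ + ‖(1 - M)ᵀ‖ * ‖W‖ :=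
          norm_add_le_of_le (norm_mul_le _ _) (norm_mul_le _ _)
      _ = 2 * ‖1 - M‖ * ‖W‖ := by rw [hT]; ring
  exact norm_eq_zero.mp (by nlinarith [norm_nonneg W])

/-- Let `n ≥ 1` and let `K, P, A` be real `n×n` matrices with `P` symmetric and
invertible.  Assume `A = (1/2)(K + Kᵀ)`, that `K·P⁻¹·A` is symmetric, and that
`‖I − P⁻¹·A‖ < 1` in the ℓ²-operator norm.  Then `K` is symmetric and consequently `A = K`. -/
theorem symmetric_of_sym_fixed_point {n : ℕ} (hn : 1 ≤ n)
    (K P A : Matrix (Fin n) (Fin n) ℝ)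
    (hP : Pᵀ = P) (hPinv : IsUnit P)
    (hA : A = (1 / 2 : ℝ) • (K + Kᵀ))
    (hsym : (K * P⁻¹ * A)ᵀ = K * P⁻¹ * A)
    (hnorm : l2OpNorm (1 - P⁻¹ * A) < 1) :
    Kᵀ = K ∧ A = K := by
  have hKT : Kᵀ = A + A - K := by
    rw [hA, ← two_smul ℝ, smul_smul]
    norm_num
  have hAT : Aᵀ = A := by
    rw [hA, transpose_smul, transpose_add, transpose_transpose, add_comm]
  have hPT : (P⁻¹)ᵀ = P⁻¹ := by rw [transpose_nonsing_inv, hP]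
  have hW : (A - K) * (P⁻¹ * A) + (P⁻¹ * A)ᵀ * (A - K) = 0 := by
    rw [transpose_mul, transpose_mul, hAT, hPT, hKT] at hsym
    rw [transpose_mul, hAT, hPT]
    calc _ = A * (P⁻¹ * (A + A - K)) - K * P⁻¹ * A := by noncomm_ring
      _ = 0 := sub_eq_zero.mpr hsym
  have hAK : A = K := sub_eq_zero.mp (eq_zero_of_mul_add_transpose_mul_eq_zero hW hnorm)
  exact ⟨hAK ▸ hAT, hAK⟩
end

section
/- Let A : ℝ → M_n(ℝ) and f : ℝ → M_n(ℝ) be such that for every t ∈ ℝ the map A has derivative f(t)·A(t) at t (HasDerivAt A (f t · A t) t) and trace(f(t)) = 0. If det(A(0)) = 1, then det(A(t)) = 1 for all t ∈ ℝ. -/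
open Matrix

attribute [local instance] Matrix.normedAddCommGroup Matrix.normedSpace

/-- **Jacobi's formula** for the derivative of the determinant of a differentiable matrix curve. -/
theorem HasDerivAt.matrix_det {𝕜 ι : Type*} [NontriviallyNormedField 𝕜] [Fintype ι]
    [DecidableEq ι] {A : 𝕜 → Matrix ι ι 𝕜} {A' : Matrix ι ι 𝕜} {t : 𝕜}
    (hA : HasDerivAt A A' t) :
    HasDerivAt (fun s ↦ (A s).det) ((A t).adjugate * A').trace t := by
  have hentry (i j : ι) : HasDerivAt (fun s ↦ A s i j) (A' i j) t :=
    hasDerivAt_pi.1 (hasDerivAt_pi.1 hA i) j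
  have hdet : HasDerivAt (fun s ↦ (A s).det)
      (∑ σ : Equiv.Perm ι, ((Equiv.Perm.sign σ : ℤ) : 𝕜) *
        ∑ i, (∏ j ∈ Finset.univ.erase i, A t (σ j) j) • A' (σ i) i) t := by
    simp only [Matrix.det_apply']
    exact HasDerivAt.fun_sum fun σ _ ↦
      (HasDerivAt.fun_finsetProd fun i _ ↦ hentry (σ i) i).const_mul _
  have hcol (i : ι) : ((A t).adjugate * A') i i = ((A t).updateCol i (A'.col i)).det := by
    rw [← Matrix.cramer_apply, Matrix.cramer_eq_adjugate_mulVec]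
    rfl
  convert hdet using 1
  simp only [Matrix.trace, Matrix.diag_apply, hcol, Matrix.det_apply', Finset.mul_sum]
  rw [Finset.sum_comm]
  refine Finset.sum_congr rfl fun σ _ ↦ Finset.sum_congr rfl fun i _ ↦ ?_
  rw [← Finset.prod_erase_mul _ _ (Finset.mem_univ i), Matrix.updateCol_self, smul_eq_mul]
  congr 2
  exact Finset.prod_congr rfl fun j hj ↦ Matrix.updateCol_ne (Finset.ne_of_mem_erase hj)

/-- **Liouville's formula** in differential form: along `A' = F * A` the determinant satisfies
`(det A)' = trace F * det A`. -/
theorem HasDerivAt.matrix_det_of_mul {𝕜 ι : Type*} [NontriviallyNormedField 𝕜] [Fintype ι]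
    [DecidableEq ι] {A : 𝕜 → Matrix ι ι 𝕜} {F : Matrix ι ι 𝕜} {t : 𝕜}
    (hA : HasDerivAt A (F * A t) t) :
    HasDerivAt (fun s ↦ (A s).det) (F.trace * (A t).det) t := by
  convert hA.matrix_det using 1
  rw [Matrix.trace_mul_comm, Matrix.mul_assoc, Matrix.mul_adjugate, Matrix.mul_smul,
    Matrix.mul_one, Matrix.trace_smul, smul_eq_mul, mul_comm]

/-- Let `A, f : ℝ → Mₙ(ℝ)` satisfy `A' (t) = f t * A t` (in the sense of
`HasDerivAt`) for all `t`, with `trace (f t) = 0` for all `t`.  If `det (A 0) = 1` then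
`det (A t) = 1` for all `t`: a trace-free flow rule exactly preserves the determinant. -/
theorem det_eq_one_of_traceless_flow {n : ℕ}
    (A f : ℝ → Matrix (Fin n) (Fin n) ℝ)
    (hderiv : ∀ t : ℝ, HasDerivAt A (f t * A t) t)
    (htrace : ∀ t : ℝ, (f t).trace = 0)
    (h0 : (A 0).det = 1) :
    ∀ t : ℝ, (A t).det = 1 := by
  intro t
  have hdet (s : ℝ) : HasDerivAt (fun s ↦ (A s).det) 0 s := by
    simpa [htrace s] using (hderiv s).matrix_det_of_mul
  rw [← h0]
  exact is_const_of_deriv_eq_zero (fun s ↦ (hdet s).differentiableAt) (fun s ↦ (hdet s).deriv) t 0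
end

section
/- Let F be an invertible real 3×3 matrix; set C_i := Fᵀ·F. Let C, T, X be arbitrary real 3×3 matrices and define Σ := F⁻ᵀ·C·T·Fᵀ − F·X·Fᵀ. Then the deviatoric part of Σ satisfies the two pull-back identities: F⁻¹·Σ^D·F⁻ᵀ = C_i⁻¹·(C·T − C_i·X)^D and Fᵀ·Σ^D·F = (C·T − C_i·X)^D·C_i. -/
open Matrix

/-- The deviatoric part of a real `3×3` matrix: `M^D = M − (trace M / 3) • 1`. -/
noncomputable def dev (M : Matrix (Fin 3) (Fin 3) ℝ) : Matrix (Fin 3) (Fin 3) ℝ :=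
  M - (M.trace / 3) • (1 : Matrix (Fin 3) (Fin 3) ℝ)

/-- The deviatoric part commutes with conjugation by an invertible matrix. -/
theorem dev_conj (A M : Matrix (Fin 3) (Fin 3) ℝ) (hA : IsUnit A.det) :
    dev (A⁻¹ * M * A) = A⁻¹ * dev M * A := by
  have htrace : (A⁻¹ * M * A).trace = M.trace := by
    rw [Matrix.trace_mul_comm, ← Matrix.mul_assoc, Matrix.mul_nonsing_inv _ hA, Matrix.one_mul]
  simp only [dev, htrace, Matrix.mul_sub, Matrix.sub_mul, Matrix.mul_smul, Matrix.smul_mul,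
    Matrix.mul_one, Matrix.nonsing_inv_mul _ hA]

/-- Let `F` be an invertible real `3×3` matrix, `C_i := Fᵀ·F`, let `C, T, X`
be arbitrary and `Σ := F⁻ᵀ·C·T·Fᵀ − F·X·Fᵀ`.  Then the deviatoric part of `Σ` satisfies the
two pull-back identities `F⁻¹·Σ^D·F⁻ᵀ = C_i⁻¹·(C·T − C_i·X)^D` and
`Fᵀ·Σ^D·F = (C·T − C_i·X)^D·C_i`. -/
theorem dev_driving_force_pullbacks
    (F C T X : Matrix (Fin 3) (Fin 3) ℝ) (hF : IsUnit F) :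
    F⁻¹ * dev (Fᵀ⁻¹ * C * T * Fᵀ - F * X * Fᵀ) * Fᵀ⁻¹ =
      (Fᵀ * F)⁻¹ * dev (C * T - (Fᵀ * F) * X) ∧
    Fᵀ * dev (Fᵀ⁻¹ * C * T * Fᵀ - F * X * Fᵀ) * F =
      dev (C * T - (Fᵀ * F) * X) * (Fᵀ * F) := by
  have hdet : IsUnit Fᵀ.det := by
    rw [Matrix.det_transpose]
    exact (Matrix.isUnit_iff_isUnit_det F).mp hF
  have hconj : Fᵀ⁻¹ * C * T * Fᵀ - F * X * Fᵀ = Fᵀ⁻¹ * (C * T - (Fᵀ * F) * X) * Fᵀ := by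
    rw [Matrix.mul_sub, Matrix.sub_mul, Matrix.mul_assoc Fᵀ F X,
      Matrix.nonsing_inv_mul_cancel_left _ _ hdet, Matrix.mul_assoc Fᵀ⁻¹ C T]
  rw [hconj, dev_conj _ _ hdet]
  constructor
  · rw [Matrix.mul_inv_rev, ← Matrix.mul_assoc, Matrix.mul_nonsing_inv_cancel_right _ _ hdet,
      ← Matrix.mul_assoc]
  · rw [Matrix.mul_assoc Fᵀ⁻¹, Matrix.mul_nonsing_inv_cancel_left _ _ hdet, Matrix.mul_assoc]
end

section
/- Let F be an invertible real 3×3 matrix; set C_i := Fᵀ·F. Let C, T, X be real 3×3 matrices, define Σ := F⁻ᵀ·C·T·Fᵀ − F·X·Fᵀ, and assume Σ is symmetric. Then the squared Frobenius norm of the deviatoric part of Σ satisfies ‖Σ^D‖_F² = trace( ((C·T − C_i·X)^D)² ). -/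
open Matrix

/-- The Frobenius norm of a real square matrix: `‖A‖_F = √(trace (A·Aᵀ))`. -/
noncomputable def frobNorm (A : Matrix (Fin 3) (Fin 3) ℝ) : ℝ :=
  Real.sqrt ((A * Aᵀ).trace)

theorem dev_conj_s14 {P Q : Matrix (Fin 3) (Fin 3) ℝ} (hPQ : P * Q = 1)
    (M : Matrix (Fin 3) (Fin 3) ℝ) : dev (P * M * Q) = P * dev M * Q := by
  have htr : (P * M * Q).trace = M.trace := by
    rw [trace_mul_comm, ← Matrix.mul_assoc, mul_eq_one_comm.mp hPQ, Matrix.one_mul]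
  simp [dev, htr, Matrix.mul_sub, Matrix.sub_mul, hPQ]

theorem dev_transpose (M : Matrix (Fin 3) (Fin 3) ℝ) : (dev M)ᵀ = dev Mᵀ := by
  simp [dev]

theorem frobNorm_sq (A : Matrix (Fin 3) (Fin 3) ℝ) : frobNorm A ^ 2 = (A * Aᵀ).trace := by
  refine Real.sq_sqrt ?_
  rw [trace]
  refine Finset.sum_nonneg fun i _ => ?_
  rw [diag_apply, mul_apply]
  exact Finset.sum_nonneg fun j _ => mul_self_nonneg (A i j)

/-- Let `F` be an invertible real `3×3` matrix, `C_i := Fᵀ·F`, let `C, T, X`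
be arbitrary, `Σ := F⁻ᵀ·C·T·Fᵀ − F·X·Fᵀ`, and assume `Σ` is symmetric.  Then
`‖Σ^D‖_F² = trace (((C·T − C_i·X)^D)²)`. -/
theorem frobNorm_sq_dev_driving_force
    (F C T X : Matrix (Fin 3) (Fin 3) ℝ) (hF : IsUnit F)
    (hsym : (Fᵀ⁻¹ * C * T * Fᵀ - F * X * Fᵀ)ᵀ = Fᵀ⁻¹ * C * T * Fᵀ - F * X * Fᵀ) :
    frobNorm (dev (Fᵀ⁻¹ * C * T * Fᵀ - F * X * Fᵀ)) ^ 2 =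
      ((dev (C * T - (Fᵀ * F) * X)) ^ 2).trace := by
  have hdet : IsUnit Fᵀ.det := by
    rw [det_transpose]
    exact (isUnit_iff_isUnit_det F).mp hF
  have hPQ : Fᵀ⁻¹ * Fᵀ = 1 := nonsing_inv_mul _ hdet
  have hconj : Fᵀ⁻¹ * C * T * Fᵀ - F * X * Fᵀ = Fᵀ⁻¹ * (C * T - (Fᵀ * F) * X) * Fᵀ := by
    have hX : Fᵀ⁻¹ * (Fᵀ * F * X) = F * X := by
      rw [Matrix.mul_assoc, ← Matrix.mul_assoc, hPQ, Matrix.one_mul]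
    rw [Matrix.mul_sub, Matrix.sub_mul, hX, Matrix.mul_assoc Fᵀ⁻¹ C T]
  rw [frobNorm_sq, dev_transpose, hsym, hconj, dev_conj_s14 hPQ]
  set D := dev (C * T - (Fᵀ * F) * X)
  have hsq : Fᵀ⁻¹ * D * Fᵀ * (Fᵀ⁻¹ * D * Fᵀ) = Fᵀ⁻¹ * (D ^ 2 * Fᵀ) := by
    rw [sq]
    simp only [Matrix.mul_assoc]
    rw [← Matrix.mul_assoc Fᵀ Fᵀ⁻¹, mul_eq_one_comm.mp hPQ, Matrix.one_mul]
  rw [hsq, trace_mul_comm, Matrix.mul_assoc, mul_eq_one_comm.mp hPQ, Matrix.mul_one]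
end

section
/- Let F, F_e, F_i be real n×n matrices with F_i invertible and F = F_e·F_i. Define the Green strain E := (1/2)(Fᵀ·F − I). Then the pull-forward of E by F_i decomposes additively: F_i⁻ᵀ·E·F_i⁻¹ = (1/2)(I − F_i⁻ᵀ·F_i⁻¹) + (1/2)(F_eᵀ·F_e − I), i.e. the total strain on the intermediate configuration is the sum of the inelastic Almansi strain and the elastic Green strain. -/
open Matrix

/-- Let `F = F_e·F_i` with `F_i` invertible, and let `E := (1/2)(Fᵀ·F − I)`
be the Green strain.  Then the pull-forward of `E` by `F_i` decomposes additively into the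
inelastic Almansi strain and the elastic Green strain:
`F_i⁻ᵀ·E·F_i⁻¹ = (1/2)(I − F_i⁻ᵀ·F_i⁻¹) + (1/2)(F_eᵀ·F_e − I)`. -/
theorem additive_strain_decomposition {n : ℕ}
    (F Fe Fi : Matrix (Fin n) (Fin n) ℝ) (hFi : IsUnit Fi)
    (hF : F = Fe * Fi) :
    Fiᵀ⁻¹ * ((1 / 2 : ℝ) • (Fᵀ * F - 1)) * Fi⁻¹ =
      (1 / 2 : ℝ) • ((1 : Matrix (Fin n) (Fin n) ℝ) - Fiᵀ⁻¹ * Fi⁻¹) +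
      (1 / 2 : ℝ) • (Feᵀ * Fe - 1) := by
  have hdet : IsUnit Fi.det := (isUnit_iff_isUnit_det Fi).1 hFi
  have hdetT : IsUnit Fiᵀ.det := by rwa [det_transpose]
  have hpull : Fiᵀ⁻¹ * (Fᵀ * F) * Fi⁻¹ = Feᵀ * Fe := by
    rw [hF, transpose_mul, Matrix.mul_assoc Fiᵀ, nonsing_inv_mul_cancel_left _ _ hdetT,
      ← Matrix.mul_assoc Feᵀ, mul_nonsing_inv_cancel_right _ _ hdet]
  rw [Matrix.mul_smul, Matrix.smul_mul, Matrix.mul_sub, Matrix.sub_mul, hpull, Matrix.mul_one,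
    ← smul_add]
  congr 1
  abel
end

section
/- Let η > 0, k₀ > 0, K > 0 and m ≥ 1 be real numbers, and let 𝔉 and R be arbitrary real numbers. Define the overstress f := 𝔉 − √(2/3)·(K + R) and the inelastic multiplier λ := (1/η)·(max(f/k₀, 0))^m (real power). Then λ·(𝔉 − √(2/3)·R) ≥ 0. Consequently the term Σ̂ : Γ̂̇_i − R·ṡ = λ·(‖Σ̂^D‖ − √(2/3)·R) in the internal dissipation is nonnegative and the material model is thermodynamically consistent. -/
/-- Let `η > 0`, `k₀ > 0`, `K > 0`, `m ≥ 1` and let `𝔉, R` be arbitrary reals.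
With the overstress `f := 𝔉 − √(2/3)·(K + R)` and the Perzyna inelastic multiplier
`λ := (1/η)·(max (f/k₀) 0)^m` (real power), one has `λ·(𝔉 − √(2/3)·R) ≥ 0`: the
corresponding term in the internal dissipation is nonnegative, so the material model is
thermodynamically consistent. -/
theorem perzyna_dissipation_nonneg
    (η k₀ K m 𝔉 R : ℝ) (hη : 0 < η) (hk₀ : 0 < k₀) (hK : 0 < K) (hm : 1 ≤ m) :
    0 ≤ (1 / η) * (max ((𝔉 - Real.sqrt (2 / 3) * (K + R)) / k₀) 0) ^ m *
        (𝔉 - Real.sqrt (2 / 3) * R) := by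
  rcases le_or_gt (𝔉 - Real.sqrt (2 / 3) * (K + R)) 0 with h | h
  · rw [max_eq_right (div_nonpos_of_nonpos_of_nonneg h hk₀.le),
      Real.zero_rpow (by linarith)]
    simp
  · have hsK : 0 ≤ Real.sqrt (2 / 3) * K := by positivity
    have hF : 0 ≤ 𝔉 - Real.sqrt (2 / 3) * R := by linarith
    positivity
end
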